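/- Let V be a commutative artinian local ring with maximal ideal m satisfying m^(m0+1) = 0 with residue field k. Let R be a V-algebra and M an R-module such that M is flat over V and M/mM is flat over R/mR. Then M is flat over R. -/

import Mathlib

open TensorProduct

/-- Finitely many elements of a span are combinations of finitely many common generators. -/
theorem Submodule.exists_common_sum_of_mem_span_image {R N ι α : Type*} [CommRing R]
    [AddCommGroup N] [Module R N] [Fintype ι] {v : α → N} {s : Set α} {w : ι → N}
    (h : ∀ i, w i ∈ Submodule.span R (v '' s)) :
    ∃ (k : ℕ) (t : Fin k → α) (c : ι → Fin k → R),
      (∀ j, t j ∈ s) ∧ ∀ i, w i = ∑ j, c i j • v (t j) := by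
  classical
  simp only [Finsupp.mem_span_image_iff_linearCombination, Finsupp.mem_supported] at h
  choose l hl hw using h
  let T : Finset α := Finset.univ.biUnion fun i ↦ (l i).support
  refine ⟨T.card, fun j ↦ (T.equivFin.symm j : α), fun i j ↦ l i (T.equivFin.symm j), ?_, ?_⟩
  · intro j
    obtain ⟨i, -, hi⟩ := Finset.mem_biUnion.1 (T.equivFin.symm j).2
    exact hl i hi
  · intro i
    rw [T.equivFin.symm.sum_comp fun t : T ↦ l i t • v t, T.sum_coe_sort fun t ↦ l i t • v t,
      ← hw i, Finsupp.linearCombination_apply]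
    exact Finsupp.sum_of_support_subset _
      (Finset.subset_biUnion_of_mem (fun i ↦ (l i).support) (Finset.mem_univ i)) _ (by simp)

/-- Finitely many elements of `I • M` are combinations, with coefficients in `I`, of finitely many
common elements of `M`. -/
theorem Submodule.exists_common_sum_of_mem_smul_top {R M ι : Type*} [CommRing R]
    [AddCommGroup M] [Module R M] [Fintype ι] {I : Ideal R} {x : ι → M}
    (h : ∀ i, x i ∈ I • (⊤ : Submodule R M)) :
    ∃ (k : ℕ) (b : ι → Fin k → R) (y : Fin k → M),
      (∀ i j, b i j ∈ I) ∧ ∀ i, x i = ∑ j, b i j • y j := by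
  have hI : I • (⊤ : Submodule R M) ≤
      span R ((fun p : R × M ↦ p.1 • p.2) '' {p | p.1 ∈ I}) :=
    Submodule.smul_le.2 fun r hr m _ ↦ subset_span ⟨(r, m), hr, rfl⟩
  obtain ⟨k, t, c, ht, hx⟩ := exists_common_sum_of_mem_span_image fun i ↦ hI (h i)
  exact ⟨k, fun i j ↦ c i j * (t j).1, fun j ↦ (t j).2, fun i j ↦ I.mul_mem_left _ (ht j),
    fun i ↦ by simp [hx i, mul_smul]⟩

/-- A relation is trivial if it is obtained by substitution from a trivial relation. -/
theorem Module.IsTrivialRelation.of_eq_sum {R M ι κ : Type*} [CommRing R] [AddCommGroup M]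
    [Module R M] [Fintype ι] [Fintype κ] {f : ι → R} {x : ι → M} (b : ι → κ → R) {y : κ → M}
    (hx : ∀ i, x i = ∑ j, b i j • y j)
    (h : IsTrivialRelation (fun j ↦ ∑ i, f i * b i j) y) : IsTrivialRelation f x := by
  obtain ⟨k, a, z, hy, ha⟩ := h
  refine ⟨k, fun i l ↦ ∑ j, b i j * a j l, z, fun i ↦ ?_, fun l ↦ ?_⟩
  · simp_rw [hx, hy, Finset.smul_sum, Finset.sum_smul, mul_smul]
    exact Finset.sum_comm
  · rw [← ha l]
    simp_rw [Finset.mul_sum, Finset.sum_mul, mul_assoc]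
    exact Finset.sum_comm

/-- If `M / IM` is flat over `R / I`, every finite system of linear relations in `M` is trivial
modulo `I`. -/
theorem Module.Flat.exists_isTrivialRelation_mod {R M ι κ : Type*} [CommRing R]
    [AddCommGroup M] [Module R M] [Fintype ι] [Fintype κ] {I : Ideal R}
    [Module.Flat (R ⧸ I) ((R ⧸ I) ⊗[R] M)] {f : κ → ι → R} {x : ι → M}
    (h : ∀ k, ∑ i, f k i • x i = 0) :
    ∃ (n : ℕ) (a : ι → Fin n → R) (y : Fin n → M),
      (∀ i, x i - ∑ j, a i j • y j ∈ I • (⊤ : Submodule R M)) ∧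
        ∀ k j, ∑ i, f k i * a i j ∈ I := by
  classical
  let q := Ideal.Quotient.mk I
  have hsmul (r : R) (m : M) : (1 : R ⧸ I) ⊗ₜ[R] (r • m) = q r • ((1 : R ⧸ I) ⊗ₜ[R] m) := by
    rw [TensorProduct.tmul_smul]
    exact (algebraMap_smul (R ⧸ I) r ((1 : R ⧸ I) ⊗ₜ[R] m)).symm
  let F : (κ → R ⧸ I) →ₗ[R ⧸ I] (ι → R ⧸ I) := Fintype.linearCombination _ fun k i ↦ q (f k i)
  let X : (ι → R ⧸ I) →ₗ[R ⧸ I] ((R ⧸ I) ⊗[R] M) :=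
    Fintype.linearCombination _ fun i ↦ (1 : R ⧸ I) ⊗ₜ[R] x i
  have hF (k : κ) : F (Pi.single k 1) = fun i ↦ q (f k i) := by
    simp [F, Fintype.linearCombination_apply_single]
  have hX (i : ι) : X (Pi.single i 1) = 1 ⊗ₜ x i := by
    simp [X, Fintype.linearCombination_apply_single]
  have hXF : X ∘ₗ F = 0 := by
    refine LinearMap.pi_ext' fun k ↦ LinearMap.ext_ring ?_
    simp only [LinearMap.comp_apply, LinearMap.single_apply, hF, LinearMap.zero_apply]
    simp only [X, Fintype.linearCombination_apply, ← hsmul, ← TensorProduct.tmul_sum, h,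
      TensorProduct.tmul_zero]
  obtain ⟨n, A, Y, hA, hAF⟩ := exists_factorization_of_comp_eq_zero_of_free hXF
  choose a ha using fun i j ↦ Ideal.Quotient.mk_surjective (A (Pi.single i 1) j)
  choose y hy using fun j ↦ TensorProduct.mk_surjective R M (R ⧸ I)
    Ideal.Quotient.mk_surjective (Y (Finsupp.single j 1))
  have hY (g : Fin n →₀ R ⧸ I) : Y g = ∑ j, g j • Y (Finsupp.single j 1) := by
    conv_lhs => rw [← Finsupp.univ_sum_single g]
    rw [map_sum]
    exact Finset.sum_congr rfl fun j _ ↦ by rw [← map_smul, Finsupp.smul_single_one]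
  refine ⟨n, a, y, fun i ↦ ?_, fun k j ↦ ?_⟩
  · rw [← Submodule.Quotient.mk_eq_zero, ← TensorProduct.quotTensorEquivQuotSMul_mk_one_tmul,
      LinearEquiv.map_eq_zero_iff, TensorProduct.tmul_sub, sub_eq_zero, ← hX, hA,
      TensorProduct.tmul_sum, LinearMap.comp_apply, hY]
    refine Finset.sum_congr rfl fun j _ ↦ ?_
    rw [hsmul, ← ha, ← hy, TensorProduct.mk_apply]
  · rw [← Ideal.Quotient.eq_zero_iff_mem]
    have := DFunLike.congr_fun (LinearMap.congr_fun hAF (Pi.single k 1)) j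
    simp only [LinearMap.comp_apply, hF, LinearMap.zero_apply, Finsupp.zero_apply] at this
    rw [← this, pi_eq_sum_univ' fun i ↦ q (f k i), map_sum, map_sum, Finsupp.finsetSum_apply]
    exact Finset.sum_congr rfl fun i _ ↦ by
      rw [map_smul, Finsupp.smul_apply, smul_eq_mul, map_mul, ha]

section

variable {V R M : Type*} [CommRing V] [CommRing R] [Algebra V R] [AddCommGroup M] [Module R M]
  [Module V M] [IsScalarTower V R M]

/-- Suppose that `M` is flat over `V` and that `M / JM` is flat over `R / JR`. Then a relation in
`M` with coefficients in `J ^ n R` is induced from one with coefficients in `J ^ (n + 1) R`. -/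
theorem Module.Flat.exists_relation_mem_pow_succ [Module.Flat V M] {J : Ideal V}
    [Module.Flat (R ⧸ J.map (algebraMap V R)) ((R ⧸ J.map (algebraMap V R)) ⊗[R] M)]
    {ι : Type*} [Fintype ι] {n : ℕ} {f : ι → R} {x : ι → M}
    (hf : ∀ i, f i ∈ (J ^ n).map (algebraMap V R)) (h : ∑ i, f i • x i = 0) :
    ∃ (p q : ℕ) (b : ι → Fin p ⊕ Fin q → R) (y : Fin p ⊕ Fin q → M),
      (∀ i, x i = ∑ j, b i j • y j) ∧
        ∀ j, ∑ i, f i * b i j ∈ (J ^ (n + 1)).map (algebraMap V R) := by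
  obtain ⟨K, v, c, hv, hfc⟩ := Submodule.exists_common_sum_of_mem_span_image hf
  have hrel : ∑ k, v k • ∑ i, c i k • x i = 0 := by
    rw [← h]
    simp_rw [hfc, Finset.sum_smul, Finset.smul_sum]
    rw [Finset.sum_comm]
    refine Finset.sum_congr rfl fun i _ ↦ Finset.sum_congr rfl fun k _ ↦ ?_
    rw [← algebraMap_smul R (v k), smul_smul, smul_eq_mul, mul_comm]
  obtain ⟨L, α, z, hz, hα⟩ := isTrivialRelation_of_sum_smul_eq_zero hrel
  obtain ⟨p, a, y, hxa, hca⟩ := exists_isTrivialRelation_mod (I := J.map (algebraMap V R))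
    (f := fun k ↦ Sum.elim (fun i ↦ c i k) fun l ↦ -algebraMap V R (α k l))
    (x := Sum.elim x z) (by simp [hz])
  obtain ⟨q, b, w, hb, hxb⟩ :=
    Submodule.exists_common_sum_of_mem_smul_top fun i ↦ hxa (Sum.inl i)
  refine ⟨p, q, fun i ↦ Sum.elim (a (Sum.inl i)) (b i), Sum.elim y w, fun i ↦ ?_, ?_⟩
  · have := hxb i
    rw [sub_eq_iff_eq_add'] at this
    simpa using this
  · rw [pow_succ, Ideal.map_mul]
    rintro (j | j)
    · have key : ∑ i, f i * a (Sum.inl i) j = ∑ k, algebraMap V R (v k) *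
          (∑ s, Sum.elim (fun i ↦ c i k) (fun l ↦ -algebraMap V R (α k l)) s * a s j) := by
        have h0 : ∑ k, algebraMap V R (v k) *
            ∑ l, algebraMap V R (α k l) * a (Sum.inr l) j = 0 := by
          simp_rw [Finset.mul_sum, ← mul_assoc, ← map_mul]
          rw [Finset.sum_comm]
          simp_rw [← Finset.sum_mul, ← map_sum, hα]
          simp
        simp only [Fintype.sum_sum_type, Sum.elim_inl, Sum.elim_inr, mul_add, neg_mul,
          Finset.sum_neg_distrib, mul_neg, Finset.sum_add_distrib, h0, neg_zero, add_zero]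
        simp_rw [hfc, Finset.sum_mul, Finset.mul_sum, smul_eq_mul]
        rw [Finset.sum_comm]
        exact Finset.sum_congr rfl fun k _ ↦ Finset.sum_congr rfl fun i _ ↦ by ring
      simp only [Sum.elim_inl, key]
      exact sum_mem fun k _ ↦ Ideal.mul_mem_mul (Ideal.mem_map_of_mem _ (hv k)) (hca k j)
    · exact sum_mem fun i _ ↦ Ideal.mul_mem_mul (hf i) (hb i j)

/-- **Local criterion of flatness** over a nilpotent ideal `J` of the base: if `M` is flat over `V`
and `M / JM` is flat over `R / JR`, then `M` is flat over `R`. -/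
theorem Module.Flat.of_flat_quotient_of_pow_eq_bot [Module.Flat V M] {J : Ideal V}
    [Module.Flat (R ⧸ J.map (algebraMap V R)) ((R ⧸ J.map (algebraMap V R)) ⊗[R] M)]
    {N : ℕ} (hJ : J ^ N = ⊥) : Module.Flat R M := by
  have trivial_of_mem_pow {n : ℕ} (hn : n ≤ N) : ∀ {ι : Type} [Fintype ι] {f : ι → R} {x : ι → M},
      (∀ i, f i ∈ (J ^ n).map (algebraMap V R)) → ∑ i, f i • x i = 0 →
        IsTrivialRelation f x := by
    induction hn using Nat.decreasingInduction with
    | self =>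
      intro ι _ f x hf _
      simp only [hJ, Ideal.map_bot, Ideal.mem_bot] at hf
      exact ⟨_, fun i j ↦ if Fintype.equivFin ι i = j then 1 else 0,
        x ∘ (Fintype.equivFin ι).symm, by simp, by simp [hf]⟩
    | of_succ n _ ih =>
      intro ι _ f x hf h
      obtain ⟨p, q, b, y, hx, hfb⟩ := exists_relation_mem_pow_succ hf h
      refine .of_eq_sum b hx (ih hfb ?_)
      rw [← h]
      simp_rw [hx, Finset.smul_sum, Finset.sum_smul, mul_smul]
      exact Finset.sum_comm
  exact of_forall_isTrivialRelation fun h ↦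
    trivial_of_mem_pow N.zero_le (by simp [Ideal.one_eq_top, Ideal.map_top]) h

end

/-- Flatness by fibres: if `M` is flat over the artinian local base `V` and the fibre
`(R/mR) ⊗_R M` is flat over `R/mR`, then `M` is flat over `R`. -/
theorem stmt6 (V R M : Type*) [CommRing V] [IsLocalRing V] [CommRing R] [Algebra V R]
    [AddCommGroup M] [Module R M] [Module V M] [IsScalarTower V R M]
    (m0 : ℕ) (hm : IsLocalRing.maximalIdeal V ^ (m0 + 1) = ⊥)
    (hMV : Module.Flat V M)
    (hfib : Module.Flat (R ⧸ (IsLocalRing.maximalIdeal V).map (algebraMap V R))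
      ((R ⧸ (IsLocalRing.maximalIdeal V).map (algebraMap V R)) ⊗[R] M)) :
    Module.Flat R M := by
  exact Module.Flat.of_flat_quotient_of_pow_eq_bot hm
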